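/- arXiv:1204.2289 — 6 statements merged into one kernel-verified Lean document; each statement's English description precedes it below -/
import Mathlib

section
/- Let m, d ≥ 1 and let Φ ∈ ℂ^{(Fin (2m) → Fin d)} be an AME(2m,d) state. Designate coordinate 0 as the dealer and for i ∈ Fin d define the slices Φ_i ∈ ℂ^{(Fin (2m−1) → Fin d)} by Φ_i(x) = √d · Φ(i ⊔ x). For a secret amplitude vector a ∈ ℂ^d with Σ_i |a_i|² = 1, let Ψ_a = Σ_{i ∈ Fin d} a_i Φ_i be the encoded state. Then Ψ_a is a unit vector, and for every subset S of the 2m−1 player coordinates with |S| ≤ m−1, the marginal ρ_S of Ψ_a equals d^{-|S|} · I. In particular the reduced state of any set of at most m−1 players is independent of the secret a, so such sets gain no information about the secret. -/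
open scoped BigOperators ComplexConjugate

/-- The function on `Fin n` agreeing with `y` on `S` and with `z` on `Sᶜ`. -/
def qMerge {n d : ℕ} (S : Finset (Fin n)) (y : {i // i ∈ S} → Fin d)
    (z : {i // i ∈ Sᶜ} → Fin d) : Fin n → Fin d :=
  fun i => if h : i ∈ S then y ⟨i, h⟩ else z ⟨i, Finset.mem_compl.mpr h⟩

/-- The marginal (reduced density matrix) of the pure state `ψ` on the qudits in `S`. -/
noncomputable def marginal {n d : ℕ} (ψ : (Fin n → Fin d) → ℂ) (S : Finset (Fin n)) :
    Matrix ({i // i ∈ S} → Fin d) ({i // i ∈ S} → Fin d) ℂ :=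
  Matrix.of fun y y' =>
    ∑ z : {i // i ∈ Sᶜ} → Fin d, ψ (qMerge S y z) * conj (ψ (qMerge S y' z))

/-- `ψ` is an absolutely maximally entangled state of `n` qudits of dimension `d`. -/
noncomputable def IsAME (n d : ℕ) (ψ : (Fin n → Fin d) → ℂ) : Prop :=
  (∑ x, Complex.normSq (ψ x)) = 1 ∧
    ∀ S : Finset (Fin n), S.card ≤ n / 2 →
      marginal ψ S = (((d : ℂ) ^ S.card)⁻¹) • 1

/-- `i ⊔ x` : the configuration of `2m` qudits taking value `i` at the dealer coordinate
`0` and agreeing with `x` on the remaining `2m - 1` (player) coordinates. -/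
def dealerMerge {m d : ℕ} (i : Fin d) (x : Fin (2 * m - 1) → Fin d) :
    Fin (2 * m) → Fin d :=
  fun j => if h : (j : ℕ) = 0 then i
    else x ⟨(j : ℕ) - 1, by have := j.isLt; omega⟩

section PlayerSubsets

variable {m d : ℕ}

/-- The player coordinate underlying a non-dealer coordinate. -/
def playerOf (j : Fin (2 * m)) (h : (j : ℕ) ≠ 0) : Fin (2 * m - 1) :=
  ⟨(j : ℕ) - 1, by have := j.isLt; omega⟩

/-- The coordinate, among all `2m` of them, of a player. -/
def coordOf (k : Fin (2 * m - 1)) : Fin (2 * m) :=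
  ⟨(k : ℕ) + 1, by have := k.isLt; omega⟩

/-- The dealer together with the players in `S`, as a set of coordinates. -/
def withDealer (S : Finset (Fin (2 * m - 1))) : Finset (Fin (2 * m)) :=
  {j | ∀ h : (j : ℕ) ≠ 0, playerOf j h ∈ S}

theorem mem_withDealer {S : Finset (Fin (2 * m - 1))} {j : Fin (2 * m)} :
    j ∈ withDealer S ↔ ∀ h : (j : ℕ) ≠ 0, playerOf j h ∈ S := by
  simp [withDealer]

theorem coordOf_injective : Function.Injective (coordOf (m := m)) := by
  intro k l h
  simpa [coordOf, Fin.ext_iff] using h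

theorem coordOf_ne_zero (k : Fin (2 * m - 1)) : (coordOf k : ℕ) ≠ 0 :=
  Nat.succ_ne_zero _

theorem playerOf_coordOf (k : Fin (2 * m - 1)) (h : (coordOf k : ℕ) ≠ 0) :
    playerOf (coordOf k) h = k := rfl

theorem coordOf_playerOf (j : Fin (2 * m)) (h : (j : ℕ) ≠ 0) : coordOf (playerOf j h) = j :=
  Fin.ext (Nat.succ_pred_eq_of_ne_zero h)

theorem coordOf_mem_withDealer {S : Finset (Fin (2 * m - 1))} {k : Fin (2 * m - 1)} :
    coordOf k ∈ withDealer S ↔ k ∈ S := by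
  simp [mem_withDealer, coordOf_ne_zero, playerOf_coordOf]

theorem ne_zero_of_mem_compl_withDealer {S : Finset (Fin (2 * m - 1))} {j : Fin (2 * m)}
    (hj : j ∈ (withDealer S)ᶜ) : (j : ℕ) ≠ 0 := by
  rw [Finset.mem_compl, mem_withDealer] at hj
  exact fun h0 => hj fun h => absurd h0 h

theorem card_withDealer (hm : 1 ≤ m) (S : Finset (Fin (2 * m - 1))) :
    (withDealer S).card = S.card + 1 := by
  have hins : withDealer S =
      insert (⟨0, by omega⟩ : Fin (2 * m)) (S.map ⟨coordOf, coordOf_injective⟩) := by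
    ext j
    rw [mem_withDealer, Finset.mem_insert, Finset.mem_map]
    constructor
    · intro h
      by_cases h0 : (j : ℕ) = 0
      · exact Or.inl (Fin.ext h0)
      · exact Or.inr ⟨playerOf j h0, h h0, coordOf_playerOf j h0⟩
    · rintro (rfl | ⟨k, hk, rfl⟩) h
      · exact absurd rfl h
      · exact hk
  rw [hins, Finset.card_insert_of_notMem, Finset.card_map]
  simp [coordOf, Fin.ext_iff]

/-- The coordinates outside `withDealer S` are the players outside `S`. -/
def complWithDealerEquiv (S : Finset (Fin (2 * m - 1))) :
    {j // j ∈ (withDealer S)ᶜ} ≃ {k // k ∈ Sᶜ} where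
  toFun j := ⟨playerOf j.1 (ne_zero_of_mem_compl_withDealer j.2), by
    rw [Finset.mem_compl, ← coordOf_mem_withDealer, coordOf_playerOf]
    exact Finset.mem_compl.mp j.2⟩
  invFun k := ⟨coordOf k.1, by
    rw [Finset.mem_compl, coordOf_mem_withDealer]
    exact Finset.mem_compl.mp k.2⟩
  left_inv j := Subtype.ext (coordOf_playerOf _ (ne_zero_of_mem_compl_withDealer j.2))
  right_inv _ := rfl

/-- A dealer value and a configuration of `S`, as a configuration of `withDealer S`. -/
def extendByDealer (S : Finset (Fin (2 * m - 1))) (i : Fin d) (y : {k // k ∈ S} → Fin d) :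
    {j // j ∈ withDealer S} → Fin d :=
  fun j => if h : (j.1 : ℕ) = 0 then i else y ⟨playerOf j.1 h, mem_withDealer.mp j.2 h⟩

theorem extendByDealer_inj (hm : 1 ≤ m) {S : Finset (Fin (2 * m - 1))} {i i' : Fin d}
    {y y' : {k // k ∈ S} → Fin d} :
    extendByDealer S i y = extendByDealer S i' y' ↔ i = i' ∧ y = y' := by
  refine ⟨fun h => ⟨?_, ?_⟩, by rintro ⟨rfl, rfl⟩; rfl⟩
  · simpa [extendByDealer] using
      congrFun h ⟨⟨0, by omega⟩, mem_withDealer.mpr fun h0 => absurd rfl h0⟩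
  · funext k
    simpa [extendByDealer, coordOf_ne_zero, playerOf_coordOf] using
      congrFun h ⟨coordOf k.1, coordOf_mem_withDealer.mpr k.2⟩

theorem qMerge_withDealer (S : Finset (Fin (2 * m - 1))) (i : Fin d)
    (y : {k // k ∈ S} → Fin d) (z : {k // k ∈ Sᶜ} → Fin d) :
    qMerge (withDealer S) (extendByDealer S i y) (z ∘ complWithDealerEquiv S) =
      dealerMerge i (qMerge S y z) := by
  funext j
  by_cases h0 : (j : ℕ) = 0
  · have hj : j ∈ withDealer S := mem_withDealer.mpr fun h => absurd h0 h
    simp [qMerge, dealerMerge, extendByDealer, hj, h0]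
  · by_cases hj : playerOf j h0 ∈ S
    · have hj' : j ∈ withDealer S := mem_withDealer.mpr fun _ => hj
      rw [playerOf] at hj
      simp [qMerge, dealerMerge, extendByDealer, hj, hj', h0, playerOf]
    · have hj' : j ∉ withDealer S := fun h => hj (mem_withDealer.mp h h0)
      rw [playerOf] at hj
      simp [qMerge, dealerMerge, hj, hj', h0, complWithDealerEquiv]
      rfl

theorem sum_dealerMerge_mul_conj (Φ : (Fin (2 * m) → Fin d) → ℂ)
    (S : Finset (Fin (2 * m - 1))) (i i' : Fin d) (y y' : {k // k ∈ S} → Fin d) :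
    ∑ z : {k // k ∈ Sᶜ} → Fin d,
        Φ (dealerMerge i (qMerge S y z)) * conj (Φ (dealerMerge i' (qMerge S y' z))) =
      marginal Φ (withDealer S) (extendByDealer S i y) (extendByDealer S i' y') := by
  rw [marginal, Matrix.of_apply,
    ← ((complWithDealerEquiv S).symm.arrowCongr (Equiv.refl (Fin d))).sum_comp]
  refine Finset.sum_congr rfl fun z _ => ?_
  simp only [← qMerge_withDealer]
  rfl

end PlayerSubsets

theorem sum_normSq_eq_marginal_empty {n d : ℕ} (ψ : (Fin n → Fin d) → ℂ)
    (y : {i // i ∈ (∅ : Finset (Fin n))} → Fin d) :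
    ((∑ x, Complex.normSq (ψ x) : ℝ) : ℂ) = marginal ψ ∅ y y := by
  let e : {i // i ∈ (∅ : Finset (Fin n))ᶜ} ≃ Fin n := Equiv.subtypeUnivEquiv (by simp)
  rw [marginal, Matrix.of_apply, ← (e.arrowCongr (Equiv.refl (Fin d))).sum_comp,
    Complex.ofReal_sum]
  refine Finset.sum_congr rfl fun z _ => ?_
  have hz : qMerge ∅ y z = e.arrowCongr (Equiv.refl (Fin d)) z := by
    funext k
    simp [qMerge, e, Equiv.arrowCongr]
  rw [hz, Complex.mul_conj]

/-- The marginals of the encoded state on unauthorized sets of players. -/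
theorem marginal_encoded {m d : ℕ} (hm : 1 ≤ m) (hd : 1 ≤ d)
    {Φ : (Fin (2 * m) → Fin d) → ℂ} (hAME : IsAME (2 * m) d Φ)
    {a : Fin d → ℂ} (ha : (∑ i, Complex.normSq (a i)) = 1)
    (S : Finset (Fin (2 * m - 1))) (hS : S.card ≤ m - 1) :
    marginal (fun x => ∑ i, a i * ((((Real.sqrt d : ℝ) : ℂ)) * Φ (dealerMerge i x))) S
      = (((d : ℂ) ^ S.card)⁻¹) • 1 := by
  have hd0 : (d : ℂ) ≠ 0 := Nat.cast_ne_zero.mpr (by omega)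
  have hsqrt : ((Real.sqrt d : ℝ) : ℂ) * ((Real.sqrt d : ℝ) : ℂ) = d := by
    rw [← Complex.ofReal_mul, Real.mul_self_sqrt (Nat.cast_nonneg d), Complex.ofReal_natCast]
  have haC : ∑ i, a i * conj (a i) = 1 := by
    simp only [Complex.mul_conj, ← Complex.ofReal_sum, ha, Complex.ofReal_one]
  have hmarg := hAME.2 (withDealer S) (by rw [card_withDealer hm]; omega)
  rw [card_withDealer hm] at hmarg
  ext y y'
  calc
    _ = ∑ i, ∑ j, a i * conj (a j) * d * ∑ z : {k // k ∈ Sᶜ} → Fin d,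
          Φ (dealerMerge i (qMerge S y z)) * conj (Φ (dealerMerge j (qMerge S y' z))) := by
      simp only [marginal, Matrix.of_apply, map_sum, Finset.sum_mul_sum]
      simp only [Finset.mul_sum]
      rw [Finset.sum_comm]
      refine Finset.sum_congr rfl fun i _ => ?_
      rw [Finset.sum_comm]
      refine Finset.sum_congr rfl fun j _ => Finset.sum_congr rfl fun z _ => ?_
      simp only [map_mul, Complex.conj_ofReal, ← hsqrt]
      ring
    _ = ∑ i, a i * conj (a i) * (((d : ℂ) ^ S.card)⁻¹ * if y = y' then 1 else 0) := by
      refine Finset.sum_congr rfl fun i _ => ?_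
      simp only [sum_dealerMerge_mul_conj, hmarg, Matrix.smul_apply, Matrix.one_apply,
        extendByDealer_inj hm, smul_eq_mul]
      rw [Finset.sum_eq_single i (fun j _ hj => by simp [hj.symm]) (by simp)]
      simp only [true_and]
      field_simp
      ring
    _ = _ := by
      rw [← Finset.sum_mul, haC, one_mul, Matrix.smul_apply, Matrix.one_apply, smul_eq_mul]

/-- encoding a secret `∑ i, a i • |i⟩` into `Ψ_a = ∑ i, a i • Φ_i`, where
`Φ_i x = √d • Φ (i ⊔ x)` are the dealer slices of an `AME(2m,d)` state `Φ`, yields a unit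
vector whose marginal on any set `S` of at most `m - 1` players is `d^{-|S|} • 1`,
independent of the secret `a`. -/
theorem encoded_secret_hidden_from_unauthorized (m d : ℕ) (hm : 1 ≤ m) (hd : 1 ≤ d)
    (Φ : (Fin (2 * m) → Fin d) → ℂ) (hAME : IsAME (2 * m) d Φ)
    (a : Fin d → ℂ) (ha : (∑ i, Complex.normSq (a i)) = 1) :
    ((∑ x, Complex.normSq
        (∑ i, a i * ((((Real.sqrt d : ℝ) : ℂ)) * Φ (dealerMerge i x)))) = 1)
    ∧ ∀ S : Finset (Fin (2 * m - 1)), S.card ≤ m - 1 →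
        marginal (fun x => ∑ i, a i * ((((Real.sqrt d : ℝ) : ℂ)) * Φ (dealerMerge i x))) S
          = (((d : ℂ) ^ S.card)⁻¹) • 1 := by
  have hmarg := marginal_encoded hm hd hAME ha
  refine ⟨?_, hmarg⟩
  rw [← Complex.ofReal_inj, sum_normSq_eq_marginal_empty _ (fun i => absurd i.2 (Finset.notMem_empty _)),
    hmarg ∅ (by simp)]
  simp
end

section
/- Let m, d ≥ 1 and let Φ ∈ ℂ^{(Fin (2m) → Fin d)} be an AME(2m,d) state, with dealer coordinate 0 and slices Φ_i(x) = √d · Φ(i ⊔ x) on the 2m−1 player coordinates. Let A be any subset of the player coordinates with |A| = m, let B be the complementary set of m−1 players, and fix a designated element p ∈ A. Then there exist a bijection σ : B ≃ A \ {p} and a unitary operator U on ℂ^{(A → Fin d)} such that for every a ∈ ℂ^d, applying U to the A-tensor-factor of the encoded state Σ_{i ∈ Fin d} a_i Φ_i yields the state whose component at (y_B, y_A) (y_B : B → Fin d, y_A : A → Fin d) equals d^{-(m−1)/2} · [y_A(σ(b)) = y_B(b) for all b ∈ B] · a(y_A(p)); that is, the unitary recovery operation of the authorized set A converts the encoded state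 into the product of a maximally entangled state pairing each player b ∈ B with σ(b) ∈ A, and the secret state Σ_i a_i e_i held at position p. -/
open scoped BigOperators ComplexConjugate

/-- The position among all `2m` qudits of a player. -/
def playerEmb (m : ℕ) : Fin (2 * m - 1) ↪ Fin (2 * m) where
  toFun k := ⟨(k : ℕ) + 1, by have := k.isLt; omega⟩
  inj' k l h := by
    simp only [Fin.mk.injEq] at h
    exact Fin.ext (by omega)

@[simp]
theorem coe_playerEmb {m : ℕ} (k : Fin (2 * m - 1)) : (playerEmb m k : ℕ) = k + 1 := rfl

/-- The dealer and the players outside `A`. -/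
def dealerCompl {m : ℕ} (A : Finset (Fin (2 * m - 1))) : Finset (Fin (2 * m)) :=
  (A.map (playerEmb m))ᶜ

theorem card_dealerCompl {m : ℕ} {A : Finset (Fin (2 * m - 1))} (hA : A.card = m) :
    (dealerCompl A).card = m := by
  rw [dealerCompl, Finset.card_compl, Finset.card_map, Fintype.card_fin, hA]
  omega

/-- The players in `A` are the qudits outside `dealerCompl A`. -/
noncomputable def playersEquiv {m : ℕ} (A : Finset (Fin (2 * m - 1))) :
    {i // i ∈ A} ≃ {i // i ∈ (dealerCompl A)ᶜ} :=
  Equiv.ofBijective (fun a => ⟨playerEmb m a, by simp [dealerCompl]⟩) <| by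
    constructor
    · intro a b h
      exact Subtype.ext ((playerEmb m).injective (congrArg Subtype.val h))
    · rintro ⟨j, hj⟩
      simp only [dealerCompl, compl_compl, Finset.mem_map] at hj
      obtain ⟨a, ha, rfl⟩ := hj
      exact ⟨⟨a, ha⟩, rfl⟩

theorem dealerMerge_playerEmb {m d : ℕ} (i : Fin d) (x : Fin (2 * m - 1) → Fin d)
    (k : Fin (2 * m - 1)) : dealerMerge i x (playerEmb m k) = x k := by
  simp [dealerMerge]

theorem eq_playerEmb_of_ne_zero {m : ℕ} (j : Fin (2 * m)) (hj : (j : ℕ) ≠ 0) :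
    ∃ k, j = playerEmb m k :=
  ⟨⟨(j : ℕ) - 1, by have := j.isLt; omega⟩,
    Fin.ext (by rw [coe_playerEmb]; dsimp only; omega)⟩

/-- The dealer's value `i` and the values `y` outside `A`, as a configuration on
`dealerCompl A`. -/
def dealerConfig {m d : ℕ} (A : Finset (Fin (2 * m - 1))) (i : Fin d)
    (y : {i // i ∈ Aᶜ} → Fin d) : {j // j ∈ dealerCompl A} → Fin d :=
  fun j => dealerMerge i (qMerge A (fun _ => i) y) j

theorem qMerge_dealerConfig {m d : ℕ} (A : Finset (Fin (2 * m - 1))) (i : Fin d)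
    (y : {i // i ∈ Aᶜ} → Fin d) (z : {j // j ∈ (dealerCompl A)ᶜ} → Fin d) :
    qMerge (dealerCompl A) (dealerConfig A i y) z =
      dealerMerge i (qMerge A (z ∘ playersEquiv A) y) := by
  funext j
  by_cases hj : (j : ℕ) = 0
  · have hS : j ∈ dealerCompl A := by
      simp only [dealerCompl, Finset.mem_compl, Finset.mem_map, not_exists, not_and]
      rintro k - rfl
      simp at hj
    simp [qMerge, hS, dealerConfig, dealerMerge, hj]
  · obtain ⟨k, rfl⟩ := eq_playerEmb_of_ne_zero j hj
    by_cases hk : k ∈ A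
    · have hS : playerEmb m k ∉ dealerCompl A := by simp [dealerCompl, hk]
      rw [dealerMerge_playerEmb]
      simp only [qMerge, hS, hk, dite_true, dite_false]
      rfl
    · have hS : playerEmb m k ∈ dealerCompl A := by simp [dealerCompl, hk]
      rw [dealerMerge_playerEmb]
      simp [qMerge, hS, hk, dealerConfig, dealerMerge_playerEmb]

theorem dealerConfig_inj {m d : ℕ} (hm : 1 ≤ m) {A : Finset (Fin (2 * m - 1))} {i j : Fin d}
    {y z : {i // i ∈ Aᶜ} → Fin d} :
    dealerConfig A i y = dealerConfig A j z ↔ i = j ∧ y = z := by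
  refine ⟨fun h => ⟨?_, ?_⟩, by rintro ⟨rfl, rfl⟩; rfl⟩
  · have h0 : (⟨0, by omega⟩ : Fin (2 * m)) ∈ dealerCompl A := by
      simp [dealerCompl, Fin.ext_iff]
    simpa [dealerConfig, dealerMerge] using congrFun h ⟨_, h0⟩
  · funext b
    have hb : (b : Fin (2 * m - 1)) ∉ A := Finset.mem_compl.mp b.2
    have hS : playerEmb m b ∈ dealerCompl A := by simp [dealerCompl, hb]
    simpa [dealerConfig, dealerMerge_playerEmb, qMerge, hb] using congrFun h ⟨_, hS⟩

/-- The slices of an `AME(2m,d)` state, further sliced along the players outside `A`, are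
orthogonal. -/
theorem IsAME.sum_slice_mul_conj {m d : ℕ} (hm : 1 ≤ m) {Φ : (Fin (2 * m) → Fin d) → ℂ}
    (hΦ : IsAME (2 * m) d Φ) {A : Finset (Fin (2 * m - 1))} (hA : A.card = m) (i j : Fin d)
    (y z : {i // i ∈ Aᶜ} → Fin d) :
    ∑ w : {i // i ∈ A} → Fin d, Φ (dealerMerge i (qMerge A w y)) *
        conj (Φ (dealerMerge j (qMerge A w z))) =
      if i = j ∧ y = z then ((d : ℂ) ^ m)⁻¹ else 0 := by
  have h := congrFun (congrFun (hΦ.2 (dealerCompl A) (by rw [card_dealerCompl hA]; omega))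
    (dealerConfig A i y)) (dealerConfig A j z)
  simp only [marginal, Matrix.of_apply, qMerge_dealerConfig, Matrix.smul_apply,
    Matrix.one_apply, dealerConfig_inj hm, card_dealerCompl hA, smul_eq_mul, mul_ite, mul_one,
    mul_zero] at h
  rw [← h]
  exact (Fintype.sum_equiv ((playersEquiv A).symm.arrowCongr (Equiv.refl (Fin d))) _ _
    fun _ => rfl).symm

/-- secret recovery by an authorized set. Given an `AME(2m,d)` state `Φ`
with dealer slices `Φ_i x = √d • Φ (i ⊔ x)`, an authorized set `A` of `m` players with a
designated player `p ∈ A`, and `B = Aᶜ` the remaining `m - 1` players, there are a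
bijection `σ : B ≃ A \ {p}` and a unitary `U` on the `A`-factor such that for every
secret amplitude `a`, applying `U` to the `A`-factor of the encoded state `∑ i, a i • Φ_i`
produces the state whose component at `(y_B, y_A)` is
`d^{-(m-1)/2} • [∀ b, y_A (σ b) = y_B b] • a (y_A p)`: maximal entanglement pairing each
`b ∈ B` with `σ b ∈ A`, in a product with the secret held at position `p`. -/
theorem authorized_set_recovers_secret (m d : ℕ) (hm : 1 ≤ m) (hd : 1 ≤ d)
    (Φ : (Fin (2 * m) → Fin d) → ℂ) (hAME : IsAME (2 * m) d Φ)
    (A : Finset (Fin (2 * m - 1))) (hA : A.card = m)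
    (p : Fin (2 * m - 1)) (hp : p ∈ A) :
    ∃ σ : {i // i ∈ Aᶜ} ≃ {i // i ∈ A.erase p},
      ∃ U : Matrix ({i // i ∈ A} → Fin d) ({i // i ∈ A} → Fin d) ℂ,
        U ∈ Matrix.unitaryGroup ({i // i ∈ A} → Fin d) ℂ ∧
        ∀ (a : Fin d → ℂ) (yB : {i // i ∈ Aᶜ} → Fin d) (yA : {i // i ∈ A} → Fin d),
          (∑ yA' : {i // i ∈ A} → Fin d, U yA yA' *
              ∑ i, a i * ((((Real.sqrt d : ℝ) : ℂ)) * Φ (dealerMerge i (qMerge A yA' yB))))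
            = ((((Real.sqrt d : ℝ) : ℂ)) ^ (m - 1))⁻¹ *
              (if ∀ b : {i // i ∈ Aᶜ},
                  yA ⟨(σ b : Fin (2 * m - 1)), Finset.mem_of_mem_erase (σ b).2⟩ = yB b
                then 1 else 0) *
              a (yA ⟨p, hp⟩) := by
  have hcard : Fintype.card {i // i ∈ Aᶜ} = Fintype.card {i // i ∈ A.erase p} := by
    rw [Fintype.card_coe, Fintype.card_coe, Finset.card_compl, Finset.card_erase_of_mem hp,
      Fintype.card_fin, hA]
    omega
  let σ : {i // i ∈ Aᶜ} ≃ {i // i ∈ A.erase p} := Fintype.equivOfCardEq hcard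
  let r : ({i // i ∈ A} → Fin d) → {i // i ∈ Aᶜ} → Fin d :=
    fun y b => y ⟨(σ b : Fin (2 * m - 1)), Finset.mem_of_mem_erase (σ b).2⟩
  have hr : ∀ y w : {i // i ∈ A} → Fin d, y ⟨p, hp⟩ = w ⟨p, hp⟩ ∧ r y = r w ↔ y = w := by
    refine fun y w => ⟨?_, by rintro rfl; simp⟩
    rintro ⟨h₁, h₂⟩
    funext ⟨q, hq⟩
    by_cases hqp : q = p
    · subst hqp
      exact h₁
    · simpa [r] using congrFun h₂ (σ.symm ⟨q, Finset.mem_erase.mpr ⟨hqp, hq⟩⟩)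
  let s : ℂ := ((Real.sqrt d : ℝ) : ℂ)
  have hs : s * s = d := by
    rw [← Complex.ofReal_mul, Real.mul_self_sqrt (Nat.cast_nonneg d), Complex.ofReal_natCast]
  have hs0 : s ≠ 0 := by
    rintro h
    have : (d : ℂ) = 0 := by rw [← hs, h, mul_zero]
    exact absurd (Nat.cast_eq_zero.mp this) (by omega)
  have hsc : conj s = s := Complex.conj_ofReal _
  let U : Matrix ({i // i ∈ A} → Fin d) ({i // i ∈ A} → Fin d) ℂ :=
    Matrix.of fun y y' => s ^ m * conj (Φ (dealerMerge (y ⟨p, hp⟩) (qMerge A y' (r y))))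
  refine ⟨σ, U, ?_, fun a yB yA => ?_⟩
  · rw [Matrix.mem_unitaryGroup_iff]
    ext y w
    have h := hAME.sum_slice_mul_conj hm hA (w ⟨p, hp⟩) (y ⟨p, hp⟩) (r w) (r y)
    simp only [hr, ← hs, mul_pow] at h
    calc (U * star U) y w
        = s ^ m * s ^ m * ∑ y', Φ (dealerMerge (w ⟨p, hp⟩) (qMerge A y' (r w))) *
            conj (Φ (dealerMerge (y ⟨p, hp⟩) (qMerge A y' (r y)))) := by
          rw [Matrix.mul_apply, Finset.mul_sum]
          refine Finset.sum_congr rfl fun y' _ => ?_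
          simp only [U, Matrix.star_apply, Matrix.of_apply, ← starRingEnd_apply, map_mul,
            map_pow, hsc, Complex.conj_conj]
          ring
      _ = (1 : Matrix _ _ ℂ) y w := by
          rw [h, Matrix.one_apply]
          by_cases hyw : y = w
          · simp only [hyw, if_true]
            exact mul_inv_cancel₀ (mul_ne_zero (pow_ne_zero m hs0) (pow_ne_zero m hs0))
          · simp [hyw, Ne.symm hyw]
  · calc _ = ∑ i, a i * (s * s ^ m * ∑ y', Φ (dealerMerge i (qMerge A y' yB)) *
            conj (Φ (dealerMerge (yA ⟨p, hp⟩) (qMerge A y' (r yA))))) := by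
          simp only [Finset.mul_sum]
          rw [Finset.sum_comm]
          refine Finset.sum_congr rfl fun i _ => Finset.sum_congr rfl fun y' _ => ?_
          simp only [U, Matrix.of_apply]
          ring
      _ = (s ^ (m - 1))⁻¹ * (if r yA = yB then 1 else 0) * a (yA ⟨p, hp⟩) := by
          simp only [hAME.sum_slice_mul_conj hm hA]
          rw [Finset.sum_eq_single (yA ⟨p, hp⟩) (by simp +contextual) (by simp)]
          obtain ⟨k, rfl⟩ := Nat.exists_eq_add_of_le' hm
          rw [← hs]
          by_cases h : r yA = yB
          · simp only [h, and_self, if_true, Nat.add_sub_cancel]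
            field_simp
            ring
          · simp [h, Ne.symm h]
      _ = _ := by simp only [funext_iff, r, s]
end

section
/- Let m, d ≥ 1 and for each i ∈ Fin d let Φ_i ∈ ℂ^{(Fin (2m−1) → Fin d)} be a state on 2m−1 qudits. Assume that for every subset B of the coordinates with |B| = m−1, the slice vectors φ_B(k,i) ∈ ℂ^{(↥Bᶜ → Fin d)} defined by φ_B(k,i)(z) = Φ_i(k ⊔ z) for k : B → Fin d satisfy ⟪φ_B(k,i), φ_B(k',j)⟫ = δ_{k k'} δ_{ij} / d^{m−1} for all k, k' and all i, j ∈ Fin d. Then the 2m-qudit state Φ ∈ ℂ^{(Fin (2m) → Fin d)} defined by Φ(i ⊔ x) = d^{-1/2} Φ_i(x) (value i at coordinate 0, x on the remaining coordinates) is an AME(2m,d) state: ρ_S(Φ) = d^{-|S|} · I for every subset S ⊆ Fin (2m) with |S| ≤ m. -/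
open scoped BigOperators ComplexConjugate

section Marginals

variable {n d : ℕ}

theorem qMerge_of_mem (S : Finset (Fin n)) (y : {i // i ∈ S} → Fin d)
    (z : {i // i ∈ Sᶜ} → Fin d) {i : Fin n} (h : i ∈ S) : qMerge S y z i = y ⟨i, h⟩ :=
  dif_pos h

theorem qMerge_of_notMem (S : Finset (Fin n)) (y : {i // i ∈ S} → Fin d)
    (z : {i // i ∈ Sᶜ} → Fin d) {i : Fin n} (h : i ∉ S) :
    qMerge S y z i = z ⟨i, Finset.mem_compl.mpr h⟩ :=
  dif_neg h

/-- Extension of `y` on `S` to `insert a S` by the value `v` at `a`. -/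
def extendInsert (S : Finset (Fin n)) (a : Fin n) (y : {i // i ∈ S} → Fin d) (v : Fin d) :
    {i // i ∈ insert a S} → Fin d :=
  fun i => if h : i.1 ∈ S then y ⟨i.1, h⟩ else v

theorem extendInsert_inj (S : Finset (Fin n)) (a : Fin n) (y y' : {i // i ∈ S} → Fin d)
    (v : Fin d) : extendInsert S a y v = extendInsert S a y' v ↔ y = y' := by
  refine ⟨fun h => ?_, fun h => h ▸ rfl⟩
  funext i
  have := congrFun h ⟨i.1, Finset.mem_insert_of_mem i.2⟩
  simpa [extendInsert, i.2] using this

/-- A configuration on `Sᶜ` is a value at `a ∉ S` and a configuration on `(insert a S)ᶜ`. -/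
def complInsertEquiv (S : Finset (Fin n)) (a : Fin n) (ha : a ∉ S) :
    ({i // i ∈ Sᶜ} → Fin d) ≃ Fin d × ({i // i ∈ (insert a S)ᶜ} → Fin d) where
  toFun z := (z ⟨a, Finset.mem_compl.mpr ha⟩, fun i => z ⟨i.1, by
    have := i.2; simp only [Finset.mem_compl, Finset.mem_insert, not_or] at this ⊢
    exact this.2⟩)
  invFun p := fun i => if h : i.1 = a then p.1 else p.2 ⟨i.1, by
    have := i.2; simp only [Finset.mem_compl, Finset.mem_insert, not_or] at this ⊢
    exact ⟨h, this⟩⟩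
  left_inv z := by
    funext i
    by_cases h : i.1 = a
    · obtain ⟨i, hi⟩ := i
      obtain rfl : i = a := h
      simp
    · simp [h]
  right_inv p := by
    refine Prod.ext (by simp) ?_
    funext i
    have h : i.1 ≠ a := by
      rintro h; have := i.2; simp [h] at this
    simp [h]

theorem marginal_eq_sum_insert (ψ : (Fin n → Fin d) → ℂ) (S : Finset (Fin n)) (a : Fin n)
    (ha : a ∉ S) (y y' : {i // i ∈ S} → Fin d) :
    marginal ψ S y y' =
      ∑ v, marginal ψ (insert a S) (extendInsert S a y v) (extendInsert S a y' v) := by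
  simp only [marginal, Matrix.of_apply]
  rw [← Fintype.sum_prod_type' (f := fun v z =>
    ψ (qMerge (insert a S) (extendInsert S a y v) z) *
      conj (ψ (qMerge (insert a S) (extendInsert S a y' v) z)))]
  have key : ∀ (y : {i // i ∈ S} → Fin d) (z : {i // i ∈ Sᶜ} → Fin d),
      qMerge S y z = qMerge (insert a S)
        (extendInsert S a y (complInsertEquiv S a ha z).1) (complInsertEquiv S a ha z).2 := by
    intro y z
    funext i
    by_cases hi : i ∈ S
    · simp [qMerge, extendInsert, hi]
    · by_cases hia : i = a
      · subst hia
        simp [qMerge, extendInsert, complInsertEquiv, hi]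
      · simp [qMerge, complInsertEquiv, hi, hia]
  exact Fintype.sum_equiv (complInsertEquiv S a ha) _ _ fun z => by rw [← key, ← key]

theorem marginal_of_insert (hd : 1 ≤ d) (ψ : (Fin n → Fin d) → ℂ) (S : Finset (Fin n))
    (a : Fin n) (ha : a ∉ S)
    (h : marginal ψ (insert a S) = (((d : ℂ) ^ (insert a S).card)⁻¹) • 1) :
    marginal ψ S = (((d : ℂ) ^ S.card)⁻¹) • 1 := by
  have hd0 : (d : ℂ) ≠ 0 := by exact_mod_cast (by omega : d ≠ 0)
  ext y y'
  rw [marginal_eq_sum_insert ψ S a ha, h, Finset.card_insert_of_notMem ha]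
  by_cases hy : y = y'
  · subst hy
    simp
    field_simp
    ring
  · simp [extendInsert_inj, hy]

theorem marginal_of_subset (hd : 1 ≤ d) (ψ : (Fin n → Fin d) → ℂ) {S T : Finset (Fin n)}
    (hST : S ⊆ T) (h : marginal ψ T = (((d : ℂ) ^ T.card)⁻¹) • 1) :
    marginal ψ S = (((d : ℂ) ^ S.card)⁻¹) • 1 := by
  have key : ∀ U : Finset (Fin n),
      marginal ψ (U ∪ S) = (((d : ℂ) ^ (U ∪ S).card)⁻¹) • 1 →
        marginal ψ S = (((d : ℂ) ^ S.card)⁻¹) • 1 := by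
    intro U
    induction U using Finset.induction_on with
    | empty => rw [Finset.empty_union]; exact id
    | insert a U _ ih =>
      rw [Finset.insert_union]
      by_cases haU : a ∈ U ∪ S
      · rwa [Finset.insert_eq_of_mem haU]
      · exact fun h => ih (marginal_of_insert hd ψ _ a haU h)
  exact key T (by rwa [Finset.union_eq_left.mpr hST])

/-- The coefficient matrix of `ψ` across the bipartition `S | Sᶜ`. -/
def coeffMatrix (ψ : (Fin n → Fin d) → ℂ) (S : Finset (Fin n)) :
    Matrix ({i // i ∈ S} → Fin d) ({i // i ∈ Sᶜ} → Fin d) ℂ :=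
  Matrix.of fun y z => ψ (qMerge S y z)

theorem marginal_eq_mul_conjTranspose (ψ : (Fin n → Fin d) → ℂ) (S : Finset (Fin n)) :
    marginal ψ S = coeffMatrix ψ S * (coeffMatrix ψ S).conjTranspose := by
  ext y y'
  simp [marginal, coeffMatrix, Matrix.mul_apply]

theorem marginal_compl_apply (ψ : (Fin n → Fin d) → ℂ) (S : Finset (Fin n))
    (z z' : {i // i ∈ Sᶜ} → Fin d) :
    marginal ψ Sᶜ z z' =
      ((coeffMatrix ψ S).conjTranspose * coeffMatrix ψ S) z' z := by
  simp only [marginal, coeffMatrix, Matrix.mul_apply, Matrix.of_apply,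
    Matrix.conjTranspose_apply]
  have key : ∀ (z : {i // i ∈ Sᶜ} → Fin d) (y : {i // i ∈ Sᶜᶜ} → Fin d),
      qMerge Sᶜ z y = qMerge S
        (fun i => y ⟨i.1, by rw [compl_compl]; exact i.2⟩) z := by
    intro z y
    funext i
    by_cases hi : i ∈ S <;> simp [qMerge, hi]
  refine Fintype.sum_equiv
    (Equiv.piCongrLeft' (fun _ => Fin d) (Equiv.subtypeEquivRight fun i => by
      rw [compl_compl] : {i // i ∈ Sᶜᶜ} ≃ {i // i ∈ S})) _ _ fun y => ?_
  rw [key, key, mul_comm]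
  rfl

theorem marginal_of_compl (hd : 1 ≤ d) (ψ : (Fin n → Fin d) → ℂ) (S : Finset (Fin n))
    (hS : S.card = Sᶜ.card)
    (h : marginal ψ Sᶜ = (((d : ℂ) ^ Sᶜ.card)⁻¹) • 1) :
    marginal ψ S = (((d : ℂ) ^ S.card)⁻¹) • 1 := by
  have hc : (d : ℂ) ^ S.card ≠ 0 := pow_ne_zero _ (by exact_mod_cast (by omega : d ≠ 0))
  set M := coeffMatrix ψ S with hM
  have h1 : M.conjTranspose * M = (((d : ℂ) ^ S.card)⁻¹) • 1 := by
    ext z' z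
    rw [hM, ← marginal_compl_apply, h, hS]
    simp [Matrix.one_apply, eq_comm]
  have h2 : (((d : ℂ) ^ S.card) • M.conjTranspose) * M = 1 := by
    rw [Matrix.smul_mul, h1, smul_smul, mul_inv_cancel₀ hc, one_smul]
  have hcard : Fintype.card ({i // i ∈ Sᶜ} → Fin d) = Fintype.card ({i // i ∈ S} → Fin d) := by
    rw [Fintype.card_fun, Fintype.card_fun, Fintype.card_coe, Fintype.card_coe, hS]
  have h3 := (Matrix.mul_eq_one_comm_of_card_eq _ _ _ hcard).mp h2
  rw [marginal_eq_mul_conjTranspose, ← hM, ← h3, Matrix.mul_smul, smul_smul,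
    inv_mul_cancel₀ hc, one_smul]

theorem sum_normSq_eq_one_of_marginal_empty (hd : 1 ≤ d) (ψ : (Fin n → Fin d) → ℂ)
    (h : marginal ψ ∅ = (((d : ℂ) ^ (∅ : Finset (Fin n)).card)⁻¹) • 1) :
    ∑ x, Complex.normSq (ψ x) = 1 := by
  let y : {i // i ∈ (∅ : Finset (Fin n))} → Fin d := fun _ => ⟨0, hd⟩
  have h0 := congrFun (congrFun h y) y
  have hsum : marginal ψ ∅ y y = ∑ x, ψ x * conj (ψ x) := by
    simp only [marginal, Matrix.of_apply]
    refine Fintype.sum_bijective (qMerge ∅ y) ⟨fun z z' hz => ?_, fun x => ?_⟩ _ _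
      fun z => rfl
    · funext i
      simpa [qMerge] using congrFun hz i.1
    · exact ⟨fun i => x i.1, by funext i; simp [qMerge]⟩
  rw [hsum] at h0
  have h1 : ((∑ x, Complex.normSq (ψ x) : ℝ) : ℂ) = 1 := by
    push_cast
    simpa [Complex.mul_conj] using h0
  exact_mod_cast h1

end Marginals

section DealerState

variable {m d : ℕ}

/-- The coordinate of `Fin (2 * m)` holding the share `j`. -/
def shareCoord (m : ℕ) (j : Fin (2 * m - 1)) : Fin (2 * m) :=
  ⟨(j : ℕ) + 1, by have := j.isLt; omega⟩

theorem shareCoord_injective (m : ℕ) : Function.Injective (shareCoord m) := by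
  intro i j h
  have := congrArg Fin.val h
  simp only [shareCoord] at this
  exact Fin.ext (by omega)

theorem exists_shareCoord_eq (hm : 0 < 2 * m) {i : Fin (2 * m)} (hi : i ≠ ⟨0, hm⟩) :
    ∃ j, shareCoord m j = i := by
  have h0 : (i : ℕ) ≠ 0 := fun h => hi (Fin.ext h)
  have := i.isLt
  exact ⟨⟨i - 1, by omega⟩, Fin.ext (by simp only [shareCoord]; omega)⟩

/-- The shares whose coordinates lie in `S`. -/
def shares (S : Finset (Fin (2 * m))) : Finset (Fin (2 * m - 1)) :=
  Finset.univ.filter fun j => shareCoord m j ∈ S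

theorem mem_shares (S : Finset (Fin (2 * m))) (j : Fin (2 * m - 1)) :
    j ∈ shares S ↔ shareCoord m j ∈ S := by
  simp [shares]

theorem card_shares (hm : 0 < 2 * m) {S : Finset (Fin (2 * m))} (h0 : ⟨0, hm⟩ ∈ S) :
    (shares S).card + 1 = S.card := by
  have : (shares S).image (shareCoord m) = S.erase ⟨0, hm⟩ := by
    ext i
    simp only [Finset.mem_image, Finset.mem_erase, mem_shares]
    constructor
    · rintro ⟨j, hj, rfl⟩
      exact ⟨fun h => by simpa [shareCoord] using congrArg Fin.val h, hj⟩
    · rintro ⟨hi, hS⟩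
      obtain ⟨j, rfl⟩ := exists_shareCoord_eq hm hi
      exact ⟨j, hS, rfl⟩
  rw [← Finset.card_image_of_injective _ (shareCoord_injective m), this,
    Finset.card_erase_add_one h0]

/-- When `S` contains the dealer, the coordinates outside `S` are the shares outside `shares S`. -/
noncomputable def complSharesEquiv (hm : 0 < 2 * m) {S : Finset (Fin (2 * m))}
    (h0 : ⟨0, hm⟩ ∈ S) : {j // j ∈ (shares S)ᶜ} ≃ {i // i ∈ Sᶜ} :=
  Equiv.ofBijective
    (fun j => ⟨shareCoord m j.1, Finset.mem_compl.mpr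
      (mt (mem_shares S j.1).mpr (Finset.mem_compl.mp j.2))⟩)
    ⟨fun i j h => Subtype.ext (shareCoord_injective m (congrArg Subtype.val h)), fun i => by
      obtain ⟨i, hi⟩ := i
      obtain ⟨j, rfl⟩ := exists_shareCoord_eq hm (i := i) (by
        rintro rfl
        exact Finset.mem_compl.mp hi h0)
      exact ⟨⟨j, by simpa [mem_shares] using hi⟩, rfl⟩⟩

theorem qMerge_comp_shareCoord (hm : 0 < 2 * m) {S : Finset (Fin (2 * m))}
    (h0 : ⟨0, hm⟩ ∈ S) (y : {i // i ∈ S} → Fin d) (z : {i // i ∈ Sᶜ} → Fin d) :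
    (fun j => qMerge S y z (shareCoord m j)) =
      qMerge (shares S) (fun j => y ⟨shareCoord m j.1, (mem_shares S j.1).mp j.2⟩)
        (fun j => z (complSharesEquiv hm h0 j)) := by
  funext j
  by_cases hj : shareCoord m j ∈ S
  · rw [qMerge_of_mem _ _ _ hj, qMerge_of_mem _ _ _ ((mem_shares S j).mpr hj)]
  · rw [qMerge_of_notMem _ _ _ hj, qMerge_of_notMem _ _ _ (mt (mem_shares S j).mp hj)]
    rfl

theorem eq_iff_eq_on_shares (hm : 0 < 2 * m) {S : Finset (Fin (2 * m))}
    (h0 : ⟨0, hm⟩ ∈ S) (y y' : {i // i ∈ S} → Fin d) :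
    ((fun j : {j // j ∈ shares S} => y' ⟨shareCoord m j.1, (mem_shares S j.1).mp j.2⟩) =
        (fun j => y ⟨shareCoord m j.1, (mem_shares S j.1).mp j.2⟩) ∧
      y' ⟨_, h0⟩ = y ⟨_, h0⟩) ↔ y = y' := by
  refine ⟨fun ⟨h1, h2⟩ => ?_, fun h => h ▸ ⟨rfl, rfl⟩⟩
  funext ⟨i, hi⟩
  by_cases hi0 : i = ⟨0, hm⟩
  · subst hi0; exact h2.symm
  · obtain ⟨j, rfl⟩ := exists_shareCoord_eq hm hi0
    exact (congrFun h1 ⟨j, (mem_shares S j).mpr hi⟩).symm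

theorem marginal_of_dealer_mem (hm : 0 < 2 * m)
    (Φs : Fin d → (Fin (2 * m - 1) → Fin d) → ℂ)
    (h : ∀ B : Finset (Fin (2 * m - 1)), B.card = m - 1 →
      ∀ (k k' : {i // i ∈ B} → Fin d) (i j : Fin d),
        (∑ z : {i // i ∈ Bᶜ} → Fin d, conj (Φs i (qMerge B k z)) * Φs j (qMerge B k' z))
          = if k = k' ∧ i = j then ((d : ℂ) ^ (m - 1))⁻¹ else 0)
    (S : Finset (Fin (2 * m))) (hS : S.card = m) (h0 : ⟨0, hm⟩ ∈ S) :
    marginal (fun x : Fin (2 * m) → Fin d => (((Real.sqrt d : ℝ) : ℂ))⁻¹ *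
      Φs (x ⟨0, hm⟩) (fun j => x (shareCoord m j))) S = (((d : ℂ) ^ S.card)⁻¹) • 1 := by
  have hB : (shares S).card = m - 1 := by have := card_shares hm h0; omega
  have hsq : (((Real.sqrt d : ℝ) : ℂ))⁻¹ * (((Real.sqrt d : ℝ) : ℂ))⁻¹ = (d : ℂ)⁻¹ := by
    rw [← mul_inv, ← Complex.ofReal_mul, Real.mul_self_sqrt (Nat.cast_nonneg d),
      Complex.ofReal_natCast]
  ext y y'
  have key := h (shares S) hB
    (fun j => y' ⟨shareCoord m j.1, (mem_shares S j.1).mp j.2⟩)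
    (fun j => y ⟨shareCoord m j.1, (mem_shares S j.1).mp j.2⟩)
    (y' ⟨_, h0⟩) (y ⟨_, h0⟩)
  simp only [eq_iff_eq_on_shares hm h0] at key
  have hpow : (d : ℂ) ^ S.card = d * (d : ℂ) ^ (m - 1) := by
    rw [← pow_succ', hS, Nat.sub_add_cancel (by omega)]
  have hrhs : ((((d : ℂ) ^ S.card)⁻¹) • (1 : Matrix ({i // i ∈ S} → Fin d) _ ℂ)) y y' =
      (d : ℂ)⁻¹ * (if y = y' then ((d : ℂ) ^ (m - 1))⁻¹ else 0) := by
    rw [hpow, mul_inv]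
    by_cases hy : y = y' <;> simp [hy]
  rw [hrhs, ← key, Finset.mul_sum]
  simp only [marginal, Matrix.of_apply]
  refine Fintype.sum_equiv
    (Equiv.piCongrLeft' (fun _ => Fin d) (complSharesEquiv hm h0).symm) _ _ fun z => ?_
  rw [qMerge_comp_shareCoord hm h0, qMerge_comp_shareCoord hm h0, qMerge_of_mem S y z h0,
    qMerge_of_mem S y' z h0, ← hsq, map_mul, map_inv₀, Complex.conj_ofReal]
  change _ = (_ * _) * (conj (Φs _ (qMerge _ _ fun j => z (complSharesEquiv hm h0 j))) *
    Φs _ (qMerge _ _ fun j => z (complSharesEquiv hm h0 j)))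
  ring

end DealerState

/-- QSS to AME. Suppose the basis states `Φ_i` of a pure state
`((m, 2m-1))` threshold quantum secret sharing scheme on `2m - 1` qudits satisfy, for
every `(m-1)`-set `B` of coordinates, the joint orthogonality relations
`⟪φ_B(k,i), φ_B(k',j)⟫ = δ_{k k'} δ_{i j} / d^{m-1}` of their slice vectors
`φ_B(k,i) = (fun z => Φ_i (k ⊔ z))`. Then the `2m`-qudit state `Φ` with
`Φ (i ⊔ x) = d^{-1/2} Φ_i x` (dealer at coordinate `0`) is an `AME(2m,d)` state. -/
theorem qss_to_ame (m d : ℕ) (hm : 1 ≤ m) (hd : 1 ≤ d)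
    (Φs : Fin d → (Fin (2 * m - 1) → Fin d) → ℂ)
    (h : ∀ B : Finset (Fin (2 * m - 1)), B.card = m - 1 →
      ∀ (k k' : {i // i ∈ B} → Fin d) (i j : Fin d),
        (∑ z : {i // i ∈ Bᶜ} → Fin d, conj (Φs i (qMerge B k z)) * Φs j (qMerge B k' z))
          = if k = k' ∧ i = j then ((d : ℂ) ^ (m - 1))⁻¹ else 0) :
    IsAME (2 * m) d (fun x : Fin (2 * m) → Fin d =>
      (((Real.sqrt d : ℝ) : ℂ))⁻¹ *
        Φs (x ⟨0, by omega⟩)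
          (fun j : Fin (2 * m - 1) => x ⟨(j : ℕ) + 1, by have := j.isLt; omega⟩)) := by
  have hm0 : 0 < 2 * m := by omega
  have half : ∀ S : Finset (Fin (2 * m)), S.card = m →
      marginal (fun x : Fin (2 * m) → Fin d => (((Real.sqrt d : ℝ) : ℂ))⁻¹ *
        Φs (x ⟨0, hm0⟩) (fun j => x (shareCoord m j))) S = (((d : ℂ) ^ S.card)⁻¹) • 1 := by
    intro S hS
    by_cases h0 : ⟨0, hm0⟩ ∈ S
    · exact marginal_of_dealer_mem hm0 Φs h S hS h0
    · have hSc : Sᶜ.card = m := by rw [Finset.card_compl, Fintype.card_fin, hS]; omega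
      exact marginal_of_compl hd _ S (hS.trans hSc.symm)
        (marginal_of_dealer_mem hm0 Φs h Sᶜ hSc (Finset.mem_compl.mpr h0))
  have all : ∀ S : Finset (Fin (2 * m)), S.card ≤ m →
      marginal (fun x : Fin (2 * m) → Fin d => (((Real.sqrt d : ℝ) : ℂ))⁻¹ *
        Φs (x ⟨0, hm0⟩) (fun j => x (shareCoord m j))) S = (((d : ℂ) ^ S.card)⁻¹) • 1 := by
    intro S hS
    obtain ⟨T, hST, hT⟩ := Finset.exists_superset_card_eq hS (by rw [Fintype.card_fin]; omega)
    exact marginal_of_subset hd _ hST (half T hT)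
  exact ⟨sum_normSq_eq_one_of_marginal_empty hd _ (all ∅ (Nat.zero_le m)),
    fun S hS => all S (by omega)⟩
end

section
/- Let |0_L⟩ ∈ ℂ^{(Fin 5 → Fin 2)} be the 5-qubit state with amplitude +1/4 on the computational basis strings 00000, 10010, 01001, 10100, 01010, 00101, amplitude −1/4 on the strings 11011, 00110, 11000, 11101, 00011, 11110, 01111, 10001, 01100, 10111, and amplitude 0 on all other strings. Then |0_L⟩ is an AME(5,2) state: it is a unit vector and ρ_S(|0_L⟩) = 2^{-|S|} · I for every subset S ⊆ Fin 5 with |S| ≤ 2. -/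
open scoped BigOperators ComplexConjugate

/-- The logical zero codeword `|0_L⟩` of the five-qubit code. -/
noncomputable def zeroL : (Fin 5 → Fin 2) → ℂ := fun x =>
  if x ∈ ([![0,0,0,0,0], ![1,0,0,1,0], ![0,1,0,0,1], ![1,0,1,0,0], ![0,1,0,1,0],
      ![0,0,1,0,1]] : List (Fin 5 → Fin 2)) then (1 / 4 : ℂ)
  else if x ∈ ([![1,1,0,1,1], ![0,0,1,1,0], ![1,1,0,0,0], ![1,1,1,0,1], ![0,0,0,1,1],
      ![1,1,1,1,0], ![0,1,1,1,1], ![1,0,0,0,1], ![0,1,1,0,0], ![1,0,1,1,1]] :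
      List (Fin 5 → Fin 2)) then (-(1 / 4) : ℂ)
  else 0

/-- Four times the amplitudes of `zeroL`: supported on strings of even weight, with the sign given
by the number of cyclically adjacent pairs of ones. -/
def zeroLInt (x : Fin 5 → Fin 2) : ℤ :=
  if (∑ i, (x i).val) % 2 = 0 then (-1) ^ (∑ i, (x i).val * (x (i + 1)).val) else 0

theorem zeroL_eq_intCast (x : Fin 5 → Fin 2) : zeroL x = (zeroLInt x : ℂ) / 4 := by
  have key : ∀ x : Fin 5 → Fin 2, zeroLInt x =
      if x ∈ ([![0,0,0,0,0], ![1,0,0,1,0], ![0,1,0,0,1], ![1,0,1,0,0], ![0,1,0,1,0],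
        ![0,0,1,0,1]] : List (Fin 5 → Fin 2)) then 1
      else if x ∈ ([![1,1,0,1,1], ![0,0,1,1,0], ![1,1,0,0,0], ![1,1,1,0,1], ![0,0,0,1,1],
        ![1,1,1,1,0], ![0,1,1,1,1], ![1,0,0,0,1], ![0,1,1,0,0], ![1,0,1,1,1]] :
        List (Fin 5 → Fin 2)) then -1
      else 0 := by
    decide +kernel
  rw [key, zeroL]
  split_ifs <;> norm_num

theorem sum_zeroLInt_sq : ∑ x, zeroLInt x * zeroLInt x = 16 := by
  decide +kernel

theorem sum_zeroLInt_qMerge : ∀ S : Finset (Fin 5), S.card ≤ 2 →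
    ∀ y y' : {i // i ∈ S} → Fin 2,
      2 ^ S.card * ∑ z : {i // i ∈ Sᶜ} → Fin 2,
        zeroLInt (qMerge S y z) * zeroLInt (qMerge S y' z) = if y = y' then 16 else 0 := by
  decide +kernel

/-- the five-qubit code state `|0_L⟩` is an `AME(5,2)` state. -/
theorem zeroL_isAME : IsAME 5 2 zeroL := by
  refine ⟨?_, fun S hS => ?_⟩
  · have h : ∀ x, Complex.normSq (zeroL x) = ((zeroLInt x * zeroLInt x : ℤ) : ℝ) / 16 := by
      intro x
      rw [zeroL_eq_intCast, Complex.normSq_div, Complex.normSq_intCast]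
      norm_num [Complex.normSq_ofNat]
    simp_rw [h, ← Finset.sum_div, ← Int.cast_sum, sum_zeroLInt_sq]
    norm_num
  · ext y y'
    have h := congrArg (Int.cast : ℤ → ℂ) (sum_zeroLInt_qMerge S hS y y')
    have hm : marginal zeroL S y y' = (∑ z : {i // i ∈ Sᶜ} → Fin 2,
        (zeroLInt (qMerge S y z) : ℂ) * zeroLInt (qMerge S y' z)) / 16 := by
      rw [marginal, Matrix.of_apply, Finset.sum_div]
      refine Finset.sum_congr rfl fun z _ => ?_
      rw [zeroL_eq_intCast, zeroL_eq_intCast, map_div₀, map_intCast, Complex.conj_ofNat]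
      ring
    rw [hm, Matrix.smul_apply, Matrix.one_apply, smul_eq_mul, Nat.cast_ofNat,
      eq_inv_mul_iff_mul_eq₀ (pow_ne_zero _ two_ne_zero), ← mul_div_assoc]
    push_cast at h
    rw [h]
    split_ifs <;> norm_num
end

section
/- Let |1_L⟩ ∈ ℂ^{(Fin 5 → Fin 2)} be the 5-qubit state with amplitude +1/4 on the computational basis strings 11111, 01101, 10110, 01011, 10101, 11010, amplitude −1/4 on the strings 00100, 11001, 00111, 00010, 11100, 00001, 10000, 01110, 10011, 01000, and amplitude 0 on all other strings. Then |1_L⟩ is an AME(5,2) state: it is a unit vector and ρ_S(|1_L⟩) = 2^{-|S|} · I for every subset S ⊆ Fin 5 with |S| ≤ 2. -/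
open scoped BigOperators ComplexConjugate

/-- The logical one codeword `|1_L⟩` of the five-qubit code. -/
noncomputable def oneL : (Fin 5 → Fin 2) → ℂ := fun x =>
  if x ∈ ([![1,1,1,1,1], ![0,1,1,0,1], ![1,0,1,1,0], ![0,1,0,1,1], ![1,0,1,0,1],
      ![1,1,0,1,0]] : List (Fin 5 → Fin 2)) then (1 / 4 : ℂ)
  else if x ∈ ([![0,0,1,0,0], ![1,1,0,0,1], ![0,0,1,1,1], ![0,0,0,1,0], ![1,1,1,0,0],
      ![0,0,0,0,1], ![1,0,0,0,0], ![0,1,1,1,0], ![1,0,0,1,1], ![0,1,0,0,0]] :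
      List (Fin 5 → Fin 2)) then (-(1 / 4) : ℂ)
  else 0

/-- The amplitudes of `oneL`, scaled by `4`. -/
def oneLAmplitude (x : Fin 5 → Fin 2) : ℤ :=
  if x ∈ ([![1,1,1,1,1], ![0,1,1,0,1], ![1,0,1,1,0], ![0,1,0,1,1], ![1,0,1,0,1],
      ![1,1,0,1,0]] : List (Fin 5 → Fin 2)) then 1
  else if x ∈ ([![0,0,1,0,0], ![1,1,0,0,1], ![0,0,1,1,1], ![0,0,0,1,0], ![1,1,1,0,0],
      ![0,0,0,0,1], ![1,0,0,0,0], ![0,1,1,1,0], ![1,0,0,1,1], ![0,1,0,0,0]] :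
      List (Fin 5 → Fin 2)) then -1
  else 0

theorem oneL_eq (x : Fin 5 → Fin 2) : oneL x = (oneLAmplitude x : ℂ) / 4 := by
  unfold oneL oneLAmplitude
  split_ifs <;> norm_num

theorem sum_oneLAmplitude_sq : ∑ x, oneLAmplitude x * oneLAmplitude x = 16 := by
  decide +kernel

theorem sum_oneLAmplitude_qMerge :
    ∀ S : Finset (Fin 5), S.card ≤ 2 → ∀ y y' : {i // i ∈ S} → Fin 2,
      2 ^ S.card * ∑ z : {i // i ∈ Sᶜ} → Fin 2,
        oneLAmplitude (qMerge S y z) * oneLAmplitude (qMerge S y' z) =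
      if y = y' then 16 else 0 := by
  decide +kernel

/-- the five-qubit code state `|1_L⟩` is an `AME(5,2)` state. -/
theorem oneL_isAME : IsAME 5 2 oneL := by
  refine ⟨?_, fun S hS => ?_⟩
  · have h : ∀ x, Complex.normSq (oneL x) =
        ((oneLAmplitude x * oneLAmplitude x : ℤ) : ℝ) / 16 := fun x => by
      rw [oneL_eq, Complex.normSq_div, Complex.normSq_intCast]
      norm_num [Complex.normSq_ofNat]
    simp_rw [h]
    rw [← Finset.sum_div, ← Int.cast_sum, sum_oneLAmplitude_sq]
    norm_num
  · ext y y'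
    have h := congrArg (Int.cast : ℤ → ℂ) (sum_oneLAmplitude_qMerge S hS y y')
    have hterm : ∀ z : {i // i ∈ Sᶜ} → Fin 2,
        oneL (qMerge S y z) * conj (oneL (qMerge S y' z)) =
          ((oneLAmplitude (qMerge S y z) * oneLAmplitude (qMerge S y' z) : ℤ) : ℂ) / 16 :=
      fun z => by
        simp only [oneL_eq, map_div₀, map_intCast, Complex.conj_ofNat]
        push_cast
        ring
    simp only [marginal, Matrix.of_apply, Matrix.smul_apply, Matrix.one_apply, smul_eq_mul]
    simp_rw [hterm]
    rw [← Finset.sum_div, ← Int.cast_sum, eq_inv_mul_iff_mul_eq₀ (by simp), ← mul_div_assoc]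
    rw [Int.cast_mul, Int.cast_pow] at h
    rw [Nat.cast_ofNat]
    rw [Int.cast_ofNat] at h
    rw [h]
    split_ifs <;> norm_num
end

section
/- Let |0_L⟩, |1_L⟩ ∈ ℂ^{(Fin 5 → Fin 2)} be the five-qubit code states: |0_L⟩ has amplitude +1/4 on the strings 00000, 10010, 01001, 10100, 01010, 00101 and −1/4 on 11011, 00110, 11000, 11101, 00011, 11110, 01111, 10001, 01100, 10111 (zero elsewhere); |1_L⟩ has amplitude +1/4 on 11111, 01101, 10110, 01011, 10101, 11010 and −1/4 on 00100, 11001, 00111, 00010, 11100, 00001, 10000, 01110, 10011, 01000 (zero elsewhere). Define the 6-qubit state Φ ∈ ℂ^{(Fin 6 → Fin 2)} by Φ(i ⊔ x) = 2^{-1/2} · (|0_L⟩(x) if i = 0, |1_L⟩(x) if i = 1), i.e. Φ = 2^{-1/2}(|0⟩⊗|0_L⟩ + |1⟩⊗|1_L⟩). Then Φ is an AME(6,2) state: it is a unit vector and ρ_S(Φ) = 2^{-|S|} · I for every subset S ⊆ Fin 6 with |S| ≤ 3. -/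
open scoped BigOperators ComplexConjugate

/-- The six-qubit state `Φ = 2^{-1/2} (|0⟩ ⊗ |0_L⟩ + |1⟩ ⊗ |1_L⟩)`, i.e.
`Φ (i ⊔ x) = 2^{-1/2} (|0_L⟩ x if i = 0, |1_L⟩ x if i = 1)`. -/
noncomputable def sixQubit : (Fin 6 → Fin 2) → ℂ := fun y =>
  (((Real.sqrt 2 : ℝ) : ℂ))⁻¹ *
    (if y 0 = 0 then zeroL (fun j : Fin 5 => y j.succ) else oneL (fun j : Fin 5 => y j.succ))

/-- The integer amplitudes `0, 1, -1` of `√32 • sixQubit`: strings of even weight carry a sign given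
by a quadratic form on the five-cycle. -/
def sixQubitSign (x : Fin 6 → Fin 2) : ℤ :=
  if x 0 + x 1 + x 2 + x 3 + x 4 + x 5 = 0 then
    if x 0 + x 1 * x 2 + x 2 * x 3 + x 3 * x 4 + x 4 * x 5 + x 5 * x 1 = 0 then 1 else -1
  else 0

theorem sixQubit_eq_sign (x : Fin 6 → Fin 2) :
    sixQubit x = (Real.sqrt 2 : ℂ)⁻¹ * (1 / 4 * sixQubitSign x) := by
  unfold sixQubit zeroL oneL
  congr 1
  have of_sign {a : ℂ} {m : ℤ} (hm : sixQubitSign x = m) (ha : a = 1 / 4 * m) :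
      a = 1 / 4 * sixQubitSign x := hm ▸ ha
  split_ifs with h₀ h₁ h₂ h₁ h₂
  all_goals first
    | refine of_sign (m := 1) ?_ (by norm_num)
      clear of_sign
      revert x
      decide +kernel
    | refine of_sign (m := -1) ?_ (by norm_num)
      clear of_sign
      revert x
      decide +kernel
    | refine of_sign (m := 0) ?_ (by norm_num)
      clear of_sign
      revert x
      decide +kernel

theorem sixQubit_mul_conj (x x' : Fin 6 → Fin 2) :
    sixQubit x * conj (sixQubit x') = 1 / 32 * ((sixQubitSign x * sixQubitSign x' : ℤ) : ℂ) := by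
  have h : (Real.sqrt 2 : ℂ)⁻¹ * (Real.sqrt 2 : ℂ)⁻¹ = 1 / 2 := by
    rw [← mul_inv, ← Complex.ofReal_mul, Real.mul_self_sqrt (by norm_num)]
    norm_num
  simp only [sixQubit_eq_sign, map_mul, map_inv₀, map_div₀, Complex.conj_ofReal, map_one,
    map_ofNat, map_intCast]
  push_cast
  linear_combination (1 / 16 * (sixQubitSign x : ℂ) * sixQubitSign x') * h

theorem sum_sixQubitSign_mul : ∀ S : Finset (Fin 6), S.card ≤ 3 →
    ∀ y y' : {i // i ∈ S} → Fin 2,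
      2 ^ S.card * ∑ z : {i // i ∈ Sᶜ} → Fin 2,
        sixQubitSign (qMerge S y z) * sixQubitSign (qMerge S y' z) = if y = y' then 32 else 0 := by
  decide +kernel

theorem sum_sixQubitSign_sq : ∑ x, sixQubitSign x * sixQubitSign x = 32 := by
  decide +kernel

/-- the six-qubit state `2^{-1/2}(|0⟩⊗|0_L⟩ + |1⟩⊗|1_L⟩)` built from the
five-qubit code is an `AME(6,2)` state. -/
theorem sixQubit_isAME : IsAME 6 2 sixQubit := by
  refine ⟨?_, fun S hS => ?_⟩
  · apply Complex.ofReal_injective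
    push_cast
    simp_rw [← Complex.mul_conj, sixQubit_mul_conj]
    rw [← Finset.mul_sum, ← Int.cast_sum, sum_sixQubitSign_sq]
    norm_num
  · ext y y'
    have h := congrArg (Int.cast : ℤ → ℂ) (sum_sixQubitSign_mul S hS y y')
    simp only [marginal, Matrix.of_apply, sixQubit_mul_conj, Matrix.smul_apply, Matrix.one_apply,
      smul_eq_mul]
    rw [← Finset.mul_sum, ← Int.cast_sum, eq_inv_mul_iff_mul_eq₀ (by simp)]
    rw [Int.cast_mul] at h
    push_cast at h ⊢
    split_ifs at h ⊢ <;> linear_combination 1 / 32 * h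
end
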